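/- Let k ≥ 3 and let q and q' be any two non-condensible permutations of length k, each with first entry smaller than last entry. Then V_n(q) = V_n(q') for every n; that is, all such patterns of length k are very tightly avoided by the same number of permutations of length n. -/

import Mathlib

/-- `p` has a *very tight* occurrence of the pattern `q` in the window of
positions `i, i+1, …, i+k-1` (0-indexed; this corresponds to the window
`p_{i+1} ⋯ p_{i+k}` in 1-indexed notation): the window is order-isomorphic
to `q` and its set of values is an interval of `k` consecutive values. -/
def IsVTO {n k : ℕ} (p : Equiv.Perm (Fin n)) (q : Equiv.Perm (Fin k)) (i : ℕ) : Prop :=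
  ∃ _hik : i + k ≤ n, ∃ a : ℕ, a + k ≤ n ∧
    (∀ j r : Fin k, q j < q r ↔
      p ⟨i + (j : ℕ), by have := j.isLt; omega⟩ <
        p ⟨i + (r : ℕ), by have := r.isLt; omega⟩) ∧
    Finset.image (fun j : Fin k => (p ⟨i + (j : ℕ), by have := j.isLt; omega⟩ : ℕ))
      Finset.univ = Finset.Ico a (a + k)

/-- The number of very tight occurrences of `q` in `p`. -/
noncomputable def numVTO {n k : ℕ} (p : Equiv.Perm (Fin n)) (q : Equiv.Perm (Fin k)) : ℕ :=
  Set.ncard {i : ℕ | IsVTO p q i}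

/-- The pattern `q` is condensible with parameter `s`: `1 ≤ s ≤ k-1`, the
rightmost `s` entries of `q` are its `s` largest entries, the leftmost `s`
entries are its `s` smallest entries, and the leftmost `s` entries are
order-isomorphic to the rightmost `s` entries. (0-indexed.) -/
def CondensibleAt {k : ℕ} (q : Equiv.Perm (Fin k)) (s : ℕ) : Prop :=
  ∃ _hs1 : 1 ≤ s, ∃ _hs2 : s ≤ k - 1,
    (∀ j : Fin k, k - s ≤ (j : ℕ) → k - s ≤ (q j : ℕ)) ∧
    (∀ j : Fin k, (j : ℕ) < s → (q j : ℕ) < s) ∧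
    ∀ j r : Fin k, ∀ _hj : (j : ℕ) < s, ∀ _hr : (r : ℕ) < s,
      (q j < q r ↔
        q ⟨(j : ℕ) + (k - s), by omega⟩ < q ⟨(r : ℕ) + (k - s), by omega⟩)

/-- The pattern `q` is condensible. -/
def Condensible {k : ℕ} (q : Equiv.Perm (Fin k)) : Prop :=
  ∃ s : ℕ, CondensibleAt q s

/-- `V n q`: the number of permutations of length `n` that very tightly avoid
the pattern `q`, i.e. have no very tight occurrence of `q`. -/
noncomputable def numVTAvoiders (n : ℕ) {k : ℕ} (q : Equiv.Perm (Fin k)) : ℕ :=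
  Nat.card {p : Equiv.Perm (Fin n) // ∀ i : ℕ, ¬ IsVTO p q i}

/-- A permutation of `Fin k` matching initial segments of positions and values matches
segments of equal length. -/
theorem eq_of_forall_lt_iff_perm_lt {k s t : ℕ} (q : Equiv.Perm (Fin k)) (hs : s ≤ k) (ht : t ≤ k)
    (h : ∀ j : Fin k, (j : ℕ) < s ↔ (q j : ℕ) < t) : s = t := by
  have hcard : Fintype.card {j : Fin k // (j : ℕ) < s} = Fintype.card {j : Fin k // (j : ℕ) < t} :=
    Fintype.card_congr (q.subtypeEquiv h)
  simpa [Fintype.card_subtype, Fin.card_filter_val_lt, hs, ht] using hcard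

/-- The window of length `k` starting at position `i`. -/
def windowEmb (n k : ℕ) (i : Fin (n + 1 - k)) : Fin k ↪ Fin n where
  toFun j := ⟨i + j, by omega⟩
  inj' j r h := by
    rw [Fin.mk.injEq] at h
    exact Fin.ext (by omega)

@[simp]
theorem windowEmb_val {n k : ℕ} (i : Fin (n + 1 - k)) (j : Fin k) :
    (windowEmb n k i j : ℕ) = i + j := rfl

theorem isVTO_iff {n k : ℕ} (p : Equiv.Perm (Fin n)) (q : Equiv.Perm (Fin k))
    (i : Fin (n + 1 - k)) :
    IsVTO p q i ↔ ∃ a : ℕ, a + k ≤ n ∧ ∀ j, (p (windowEmb n k i j) : ℕ) = a + q j := by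
  constructor
  · rintro ⟨hik, a, ha, hord, himg⟩
    refine ⟨a, ha, ?_⟩
    have hf : StrictMono fun m : Fin k => (p (windowEmb n k i (q.symm m)) : ℕ) := fun m m' hm =>
      (hord (q.symm m) (q.symm m')).1 (by simpa using hm)
    have hg : StrictMono fun m : Fin k => a + (m : ℕ) := fun m m' hm =>
      Nat.add_lt_add_left hm a
    have hfg := (hf.range_inj hg).1 <| by
      ext v
      have hv := Finset.ext_iff.1 himg v
      simp only [Finset.mem_image, Finset.mem_univ, true_and, Finset.mem_Ico] at hv
      simp only [Set.mem_range]
      rw [← q.symm.surjective.exists (p := fun j => (p (windowEmb n k i j) : ℕ) = v)]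
      refine hv.trans ⟨fun h => ⟨⟨v - a, by omega⟩, by simp only; omega⟩, ?_⟩
      rintro ⟨m, rfl⟩
      omega
    intro j
    simpa using congrFun hfg (q j)
  · rintro ⟨a, ha, h⟩
    refine ⟨by omega, a, ha, fun j r => ?_, ?_⟩
    · have hj := h j
      have hr := h r
      change _ ↔ ((p (windowEmb n k i j) : ℕ) < p (windowEmb n k i r))
      rw [hj, hr]
      simp
    · ext v
      simp only [Finset.mem_image, Finset.mem_univ, true_and, Finset.mem_Ico]
      constructor
      · rintro ⟨j, rfl⟩
        have hj := h j
        have := (q j).isLt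
        change a ≤ (p (windowEmb n k i j) : ℕ) ∧ (p (windowEmb n k i j) : ℕ) < a + k
        omega
      · rintro ⟨h1, h2⟩
        refine ⟨q.symm ⟨v - a, by omega⟩, (h _).trans ?_⟩
        simp only [Equiv.apply_symm_apply]
        omega

theorem IsVTO.add_le {n k : ℕ} {p : Equiv.Perm (Fin n)} {q : Equiv.Perm (Fin k)}
    (hk : 0 < k) (hq : q ⟨0, by omega⟩ < q ⟨k - 1, by omega⟩) (hnc : ¬ Condensible q)
    {i i' : Fin (n + 1 - k)} (hi : IsVTO p q i) (hi' : IsVTO p q i') (hlt : i < i') :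
    (i : ℕ) + k ≤ i' := by
  obtain ⟨a, -, h⟩ := (isVTO_iff p q i).1 hi
  obtain ⟨a', -, h'⟩ := (isVTO_iff p q i').1 hi'
  by_contra hov
  have hlt' : (i : ℕ) < i' := hlt
  obtain ⟨d, hd⟩ : ∃ d, (i' : ℕ) = i + d := ⟨i' - i, by omega⟩
  have hshift (j r : Fin k) (hjr : (r : ℕ) = j + d) : a + (q r : ℕ) = a' + q j := by
    rw [← h, ← h']
    congr 2
    ext
    simp only [windowEmb_val]
    omega
  have hpos (j r : Fin k) (hv : a + (q r : ℕ) = a' + q j) : (r : ℕ) = j + d := by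
    rw [← h, ← h'] at hv
    have hv' := congrArg Fin.val (p.injective (Fin.ext hv))
    simp only [windowEmb_val] at hv'
    omega
  have hvalue (v : ℕ) (hv : v < k) : ∃ j : Fin k, (q j : ℕ) = v := ⟨q.symm ⟨v, hv⟩, by simp⟩
  obtain hlow | hhigh := lt_or_ge a' a
  · obtain ⟨b, rfl⟩ : ∃ b, a = a' + b := ⟨a - a', by omega⟩
    have hlast := hshift ⟨k - 1 - d, by omega⟩ ⟨k - 1, by omega⟩ (by simp only; omega)
    have hfirst : (q ⟨0, hk⟩ : ℕ) < q ⟨k - 1, by omega⟩ := hq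
    obtain ⟨j, hj⟩ := hvalue (b + q ⟨0, hk⟩) (by omega)
    have := hpos j ⟨0, hk⟩ (by omega)
    simp only at this
    omega
  · obtain ⟨b, rfl⟩ : ∃ b, a' = a + b := ⟨a' - a, by omega⟩
    have h0 := hshift ⟨0, hk⟩ ⟨d, by omega⟩ (by simp)
    have hbk : b ≤ k := by omega
    have hbd : k - d = k - b := by
      refine eq_of_forall_lt_iff_perm_lt q (by omega) (by omega) fun j => ⟨fun hj => ?_, fun hj => ?_⟩
      · have := hshift j ⟨j + d, by omega⟩ rfl
        omega
      · obtain ⟨r, hr⟩ := hvalue (b + q j) (by omega)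
        have := hpos j r (by omega)
        omega
    obtain rfl : b = d := by omega
    refine hnc ⟨k - b, by omega, by omega, fun j hj => ?_, fun j hj => ?_, fun j r hj hr => ?_⟩
    · have := hshift ⟨j - b, by omega⟩ j (by simp only; omega)
      omega
    · have := hshift j ⟨j + b, by omega⟩ rfl
      omega
    · have h1 := hshift j ⟨j + (k - (k - b)), by omega⟩ (by simp only; omega)
      have h2 := hshift r ⟨r + (k - (k - b)), by omega⟩ (by simp only; omega)
      rw [Fin.lt_def, Fin.lt_def]
      omega

/-- A permutation can be applied simultaneously inside finitely many disjoint embedded copies. -/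
theorem exists_perm_on_disjoint_embeddings {ι α β : Type*} [Fintype α]
    (e : ι → α ↪ β) (τ : Equiv.Perm α) (T : Finset ι)
    (hT : ∀ i ∈ T, ∀ i' ∈ T, i ≠ i' → ∀ j j', e i j ≠ e i' j') :
    ∃ σ : Equiv.Perm β, ∀ i ∈ T, ∀ j, σ (e i j) = e i (τ j) := by
  classical
  suffices ∃ σ : Equiv.Perm β, (∀ i ∈ T, ∀ j, σ (e i j) = e i (τ j)) ∧
      ∀ x, (∀ i ∈ T, ∀ j, e i j ≠ x) → σ x = x from this.imp fun _ h => h.1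
  induction T using Finset.induction_on with
  | empty => exact ⟨1, by simp, by simp⟩
  | insert i₀ T hi₀ ih =>
    obtain ⟨σ, hσ, hfix⟩ := ih fun i hi i' hi' =>
      hT i (Finset.mem_insert_of_mem hi) i' (Finset.mem_insert_of_mem hi')
    refine ⟨σ * τ.viaFintypeEmbedding (e i₀), fun i hi j => ?_, fun x hx => ?_⟩
    · obtain rfl | hiT := Finset.mem_insert.1 hi
      · rw [Equiv.Perm.mul_apply, Equiv.Perm.viaFintypeEmbedding_apply_image]
        refine hfix _ fun i' hi' j' => hT i' (Finset.mem_insert_of_mem hi') i hi ?_ _ _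
        rintro rfl
        exact hi₀ hi'
      · rw [Equiv.Perm.mul_apply, Equiv.Perm.viaFintypeEmbedding_apply_notMem_range, hσ i hiT]
        rintro ⟨j', hj'⟩
        refine hT i₀ (Finset.mem_insert_self _ _) i hi ?_ _ _ hj'
        rintro rfl
        exact hi₀ hiT
    · rw [Equiv.Perm.mul_apply, Equiv.Perm.viaFintypeEmbedding_apply_notMem_range,
        hfix x fun i hi => hx i (Finset.mem_insert_of_mem hi)]
      rintro ⟨j, hj⟩
      exact hx i₀ (Finset.mem_insert_self _ _) j hj

open Classical in
theorem card_forall_isVTO_le {n k : ℕ} (hk : 0 < k) (q q' : Equiv.Perm (Fin k))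
    (hq : q ⟨0, by omega⟩ < q ⟨k - 1, by omega⟩) (hnc : ¬ Condensible q)
    (T : Finset (Fin (n + 1 - k))) :
    (T.inf fun i => ({p : Equiv.Perm (Fin n) | IsVTO p q i} : Finset _)).card ≤
      (T.inf fun i => ({p : Equiv.Perm (Fin n) | IsVTO p q' i} : Finset _)).card := by
  obtain hempty | ⟨p₀, hp₀⟩ := Finset.eq_empty_or_nonempty
    (T.inf fun i => ({p : Equiv.Perm (Fin n) | IsVTO p q i} : Finset _))
  · simp [hempty]
  simp only [Finset.mem_inf, Finset.mem_filter_univ] at hp₀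
  obtain ⟨σ, hσ⟩ := exists_perm_on_disjoint_embeddings (windowEmb n k) (q⁻¹ * q') T <| by
    intro i hi i' hi' hne j j' h
    have hval := congrArg Fin.val h
    simp only [windowEmb_val] at hval
    obtain hlt | hlt := lt_or_gt_of_ne hne
    · have := (hp₀ i hi).add_le hk hq hnc (hp₀ i' hi') hlt
      omega
    · have := (hp₀ i' hi').add_le hk hq hnc (hp₀ i hi) hlt
      omega
  refine Finset.card_le_card_of_injOn (· * σ) (fun p hp => ?_) (mul_left_injective σ).injOn
  simp only [Finset.mem_coe, Finset.mem_inf, Finset.mem_filter_univ] at hp ⊢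
  intro i hi
  obtain ⟨a, ha, h⟩ := (isVTO_iff p q i).1 (hp i hi)
  refine (isVTO_iff _ q' i).2 ⟨a, ha, fun j => ?_⟩
  rw [Equiv.Perm.mul_apply, hσ i hi, h]
  simp

open Classical in
theorem numVTAvoiders_eq_card_inf {n k : ℕ} (q : Equiv.Perm (Fin k)) :
    numVTAvoiders n q = ((Finset.univ : Finset (Fin (n + 1 - k))).inf fun i =>
      ({p : Equiv.Perm (Fin n) | IsVTO p q i} : Finset _)ᶜ).card := by
  rw [numVTAvoiders, Nat.card_eq_fintype_card, Fintype.card_subtype]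
  congr 1
  ext p
  simp only [Finset.mem_filter_univ, Finset.mem_inf, Finset.mem_univ, Finset.mem_compl,
    forall_const]
  exact ⟨fun h i => h i, fun h i hi => h ⟨i, by have := hi.1; omega⟩ hi⟩

/-- Let `k ≥ 3` and let `q, q'` be any two non-condensible patterns of length
`k`, each with first entry smaller than last entry. Then `V_n(q) = V_n(q')`
for every `n`. -/
theorem stmt_14 {k : ℕ} (hk : 3 ≤ k) (q q' : Equiv.Perm (Fin k))
    (hq : q ⟨0, by omega⟩ < q ⟨k - 1, by omega⟩) (hnc : ¬ Condensible q)
    (hq' : q' ⟨0, by omega⟩ < q' ⟨k - 1, by omega⟩) (hnc' : ¬ Condensible q')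
    (n : ℕ) :
    numVTAvoiders n q = numVTAvoiders n q' := by
  classical
  rw [← Nat.cast_inj (R := ℤ), numVTAvoiders_eq_card_inf, numVTAvoiders_eq_card_inf,
    Finset.inclusion_exclusion_card_inf_compl, Finset.inclusion_exclusion_card_inf_compl]
  refine Finset.sum_congr rfl fun T _ => ?_
  rw [(card_forall_isVTO_le (by omega) q q' hq hnc T).antisymm
    (card_forall_isVTO_le (by omega) q' q hq' hnc' T)]
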